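/- arXiv:2409.10014 — 3 statements merged into one kernel-verified Lean document; each statement's English description precedes it below -/
import Mathlib

section
/- Let A, B, K be bounded operators on ℓ² such that A − S A S and B − S B S are compact (A and B are essentially Hankel) and S K − K S is compact (K is essentially Toeplitz). Then: (i) A K − S (A K) S is compact; (ii) K A − S (K A) S is compact; (iii) S (A B) − (A B) S is compact. In other words, the product of an essentially Hankel and an essentially Toeplitz operator (in either order) is essentially Hankel, and the product of two essentially Hankel operators is essentially Toeplitz. -/
open Filter Finset

local notation "H" => lp (fun _ : ℕ => ℂ) 2

theorem IsCompactOperator.mul_right {𝕜 E : Type*} [Semiring 𝕜] [TopologicalSpace E]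
    [AddCommMonoid E] [Module 𝕜 E] {T : E →L[𝕜] E} (hT : IsCompactOperator T)
    (R : E →L[𝕜] E) : IsCompactOperator (T * R) :=
  hT.comp_clm R

theorem IsCompactOperator.mul_left {𝕜 E : Type*} [Semiring 𝕜] [TopologicalSpace E]
    [AddCommMonoid E] [Module 𝕜 E] {T : E →L[𝕜] E} (hT : IsCompactOperator T)
    (R : E →L[𝕜] E) : IsCompactOperator (R * T) :=
  hT.clm_comp R

/-- Products of essentially Hankel and essentially Toeplitz operators:
essHank × essToep (either order) is essHank, and essHank × essHank is essToep. -/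
theorem essHankel_essToeplitz_products (S A B K : H →L[ℂ] H)
    (hS0 : ∀ a : H, (S a : ℕ → ℂ) 0 = 0)
    (hS1 : ∀ (a : H) (n : ℕ), (S a : ℕ → ℂ) (n + 1) = (a : ℕ → ℂ) n)
    (hA : IsCompactOperator (A - S * A * S))
    (hB : IsCompactOperator (B - S * B * S))
    (hK : IsCompactOperator (S * K - K * S)) :
    IsCompactOperator (A * K - S * (A * K) * S) ∧
      IsCompactOperator (K * A - S * (K * A) * S) ∧
      IsCompactOperator (S * (A * B) - (A * B) * S) := by
  refine ⟨?_, ?_, ?_⟩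
  · have h : A * K - S * (A * K) * S = (A - S * A * S) * K + S * A * (S * K - K * S) := by
      noncomm_ring
    rw [h]
    exact (hA.mul_right K).add (hK.mul_left (S * A))
  · have h : K * A - S * (K * A) * S = K * (A - S * A * S) - (S * K - K * S) * (A * S) := by
      noncomm_ring
    rw [h]
    exact (hA.mul_left K).sub (hK.mul_right (A * S))
  · have h : S * (A * B) - (A * B) * S =
        S * A * (B - S * B * S) - (A - S * A * S) * (B * S) := by
      noncomm_ring
    rw [h]
    exact (hB.mul_left (S * A)).sub (hA.mul_right (B * S))
end

section
/- Every positive bounded Hankel operator on ℓ² belongs to the Toeplitz algebra 𝒯: if A is a bounded operator on ℓ² which is positive (as an operator on a Hilbert space) and satisfies S* A = A S, then A lies in the operator-norm closure of the subalgebra of bounded operators generated by the Toeplitz operators, i.e. by the set of all bounded operators B with S* B S = B. -/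
open Filter Finset
local notation "H" => lp (fun _ : ℕ => ℂ) 2

/-- The `n`-th vector of the standard basis of `ℓ²`. -/
noncomputable abbrev basisVec (n : ℕ) : H := lp.single 2 n (1 : ℂ)

theorem hasSum_lp_two_norm_sq (x : H) : HasSum (fun i => ‖x i‖ ^ 2) (‖x‖ ^ 2) := by
  have := lp.hasSum_norm (p := 2) (by norm_num) x
  simpa using this

theorem lp_two_norm_sq_le {x : H} {C : ℝ} (h : ∀ F : Finset ℕ, ∑ i ∈ F, ‖x i‖ ^ 2 ≤ C) :
    ‖x‖ ^ 2 ≤ C :=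
  le_of_tendsto (hasSum_lp_two_norm_sq x) (Eventually.of_forall h)

theorem hasSum_smul_basisVec (x : H) : HasSum (fun n => x n • basisVec n) x := by
  have := lp.hasSum_single (p := 2) (by norm_num) x
  convert this using 2 with n
  rw [← lp.single_smul]; simp

theorem clm_ext_basisVec {E : Type*} [NormedAddCommGroup E] [NormedSpace ℂ E]
    {f g : H →L[ℂ] E} (h : ∀ n, f (basisVec n) = g (basisVec n)) : f = g := by
  ext x
  have hx := hasSum_smul_basisVec x
  have h1 := f.hasSum hx
  have h2 := g.hasSum hx
  simp only [map_smul, h] at h1 h2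
  exact h1.unique h2

/-- A matrix all of whose finite sections are uniformly bounded defines a bounded operator. -/
theorem exists_clm_of_finite_sections (m : ℕ → ℕ → ℂ) (C : ℝ)
    (h : ∀ (F G : Finset ℕ) (x : ℕ → ℂ),
      ∑ i ∈ F, ‖∑ j ∈ G, m i j * x j‖ ^ 2 ≤ C ^ 2 * ∑ j ∈ G, ‖x j‖ ^ 2) :
    ∃ T : H →L[ℂ] H, ∀ i j, T (basisVec j) i = m i j := by
  have hmem : ∀ j, Memℓp (fun i => m i j) 2 := fun j => by
    refine memℓp_gen' (C := C ^ 2) fun F => ?_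
    simpa using h F {j} 1
  let τ : ℕ → H := fun j => ⟨fun i => m i j, hmem j⟩
  have hτ : ∀ (G : Finset ℕ) (x : ℕ → ℂ),
      ‖∑ j ∈ G, x j • τ j‖ ^ 2 ≤ C ^ 2 * ∑ j ∈ G, ‖x j‖ ^ 2 := fun G x => by
    refine lp_two_norm_sq_le fun F => ?_
    convert h F G x using 4 with i hi
    rw [lp.coeFn_sum, Finset.sum_apply]
    exact Finset.sum_congr rfl fun j _ => by simp [τ, mul_comm]
  have hsum : ∀ x : H, Summable fun j => x j • τ j := fun x => by
    have hx := (hasSum_lp_two_norm_sq x).summable.mul_left (C ^ 2)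
    rw [summable_iff_vanishing_norm] at hx ⊢
    intro ε hε
    obtain ⟨s, hs⟩ := hx (ε ^ 2) (by positivity)
    refine ⟨s, fun t ht => lt_of_pow_lt_pow_left₀ 2 hε.le ((hτ t x).trans_lt ?_)⟩
    rw [Finset.mul_sum]
    exact (le_abs_self _).trans_lt (hs t ht)
  have hbound : ∀ x : H, ‖∑' j, x j • τ j‖ ≤ |C| * ‖x‖ := fun x => by
    refine le_of_sq_le_sq ?_ (by positivity)
    rw [mul_pow, sq_abs]
    exact le_of_tendsto_of_tendsto (((continuous_norm.pow 2).tendsto _).comp (hsum x).hasSum)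
      ((hasSum_lp_two_norm_sq x).mul_left (C ^ 2))
      (Eventually.of_forall fun G => by simpa [Finset.mul_sum] using hτ G x)
  refine ⟨LinearMap.mkContinuous
    { toFun := fun x => ∑' j, x j • τ j
      map_add' := fun x y => by
        rw [← (hsum x).tsum_add (hsum y)]; simp [add_smul]
      map_smul' := fun c x => by
        rw [RingHom.id_apply, ← (hsum x).tsum_const_smul]; simp [mul_smul] } |C| hbound,
    fun i j => ?_⟩
  change (∑' k, basisVec j k • τ k) i = m i j
  rw [tsum_eq_single j fun k hk => by simp [hk]]
  simp [τ]

theorem mem_topologicalClosure_of_mul_self_mem {𝒜 : Type*} [CStarAlgebra 𝒜] [PartialOrder 𝒜]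
    [StarOrderedRing 𝒜] (P : Subalgebra ℂ 𝒜) {A : 𝒜}
    (hA : 0 ≤ A) (h : A * A ∈ P) : A ∈ P.topologicalClosure := by
  have hsa : IsSelfAdjoint A := .of_nonneg hA
  have h1 : cfc Real.sqrt (A * A) = A := by
    rw [← pow_two, ← cfc_pow_id (R := ℝ) A 2, ← cfc_comp Real.sqrt (fun x : ℝ => x ^ 2) A]
    conv_rhs => rw [← cfc_id ℝ A]
    refine cfc_congr fun x hx => ?_
    simp [Real.sqrt_sq (spectrum_nonneg_of_nonneg hA hx)]
  have hsq : star (A * A) = A * A := by rw [star_mul, hsa.star_eq]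
  let Q : StarSubalgebra ℂ 𝒜 := StarAlgebra.elemental ℂ (A * A)
  have h2 : cfc Real.sqrt (A * A) ∈ Q := by
    have : IsClosed (Q : Set 𝒜) := StarAlgebra.elemental.isClosed ℂ _
    exact cfc_mem _ (StarAlgebra.elemental.self_mem ℂ _)
  rw [h1] at h2
  have h3 : (StarAlgebra.adjoin ℂ {A * A} : Set 𝒜) ⊆ P := by
    intro x hx
    have hx' : x ∈ Algebra.adjoin ℂ ({A * A} ∪ star {A * A} : Set 𝒜) := by
      rwa [← StarAlgebra.adjoin_toSubalgebra]
    refine Algebra.adjoin_le ?_ hx'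
    rintro y (hy | hy)
    · rwa [Set.mem_singleton_iff.1 hy]
    · rw [Set.mem_star, Set.mem_singleton_iff] at hy
      rwa [← star_star y, hy, hsq]
  exact closure_mono h3 h2

/-- The vector `(1, w, w², …)` of `ℓ²`, for `‖w‖ < 1`. -/
noncomputable def geomVec (w : ℂ) (hw : ‖w‖ < 1) : H :=
  ⟨fun n => w ^ n, memℓp_gen (by
    have : ‖w‖ ^ 2 < 1 := by nlinarith [norm_nonneg w]
    simpa [← pow_mul, mul_comm] using summable_geometric_of_lt_one (by positivity) this)⟩

theorem geomVec_apply (w : ℂ) (hw : ‖w‖ < 1) (n : ℕ) : geomVec w hw n = w ^ n := rfl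

theorem norm_geomVec_sq (w : ℂ) (hw : ‖w‖ < 1) : ‖geomVec w hw‖ ^ 2 = (1 - ‖w‖ ^ 2)⁻¹ := by
  have h1 : ‖w‖ ^ 2 < 1 := by nlinarith [norm_nonneg w]
  refine (hasSum_lp_two_norm_sq _).unique ?_
  simpa [geomVec_apply, ← pow_mul, mul_comm] using
    hasSum_geometric_of_lt_one (by positivity) h1

theorem exists_sqrt_of_isPositive {E : Type*} [NormedAddCommGroup E] [InnerProductSpace ℂ E]
    [CompleteSpace E] {A : E →L[ℂ] E} (hpos : A.IsPositive) :
    ∃ X : E →L[ℂ] E, ∀ x y, inner ℂ x (A y) = inner ℂ (X x) (X y) := by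
  have hA : 0 ≤ A := (ContinuousLinearMap.nonneg_iff_isPositive A).2 hpos
  refine ⟨CFC.sqrt A, fun x y => ?_⟩
  have hX : (CFC.sqrt A).IsPositive :=
    (ContinuousLinearMap.nonneg_iff_isPositive _).1 (CFC.sqrt_nonneg A)
  have := hX.isSymmetric x (CFC.sqrt A y)
  simp only [ContinuousLinearMap.coe_coe] at this
  rw [this, ← ContinuousLinearMap.comp_apply, ← ContinuousLinearMap.mul_def,
    CFC.sqrt_mul_sqrt_self A hA]

section Fourier

open MeasureTheory AddCircle

theorem fourierCoeff_mul_fourier (f : C(UnitAddCircle, ℂ)) (i j : ℤ) :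
    fourierCoeff (f * fourier j : C(UnitAddCircle, ℂ)) i = fourierCoeff f (i - j) := by
  unfold fourierCoeff
  congr 1
  ext x
  rw [neg_sub, sub_eq_neg_add, fourier_add]
  simp only [ContinuousMap.mul_apply, smul_eq_mul]
  ring

theorem hasSum_sq_norm_fourierCoeff (f : C(UnitAddCircle, ℂ)) :
    HasSum (fun i => ‖fourierCoeff f i‖ ^ 2) (∫ x, ‖f x‖ ^ 2 ∂haarAddCircle) := by
  have h := hasSum_sq_fourierCoeff (ContinuousMap.toLp (E := ℂ) 2 haarAddCircle ℂ f)
  simp only [fourierCoeff_toLp] at h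
  convert h using 1
  refine integral_congr_ae ?_
  filter_upwards [ContinuousMap.coeFn_toLp (𝕜 := ℂ) (p := 2) haarAddCircle f] with x hx
  rw [hx]

theorem integrable_of_continuousMap (f : C(UnitAddCircle, ℂ)) : Integrable f haarAddCircle :=
  f.continuous.integrable_of_hasCompactSupport (HasCompactSupport.of_compactSpace f)

theorem fourierCoeff_sum_mul_fourier (f : C(UnitAddCircle, ℂ)) (G : Finset ℕ) (x : ℕ → ℂ) (i : ℤ) :
    fourierCoeff (f * ∑ j ∈ G, x j • fourier (j : ℤ) : C(UnitAddCircle, ℂ)) i =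
      ∑ j ∈ G, fourierCoeff f (i - j) * x j := by
  have : ((f * ∑ j ∈ G, x j • fourier (j : ℤ) : C(UnitAddCircle, ℂ)) : UnitAddCircle → ℂ) =
      fun y => ∑ j ∈ G, (x j • (f * fourier (j : ℤ) : C(UnitAddCircle, ℂ))) y := by
    ext y
    simp [Finset.mul_sum]
  rw [this, ← Finset.sum_fn, fourierCoeff.sum _ _ fun j _ => integrable_of_continuousMap _,
    Finset.sum_apply]
  refine Finset.sum_congr rfl fun j _ => ?_
  rw [ContinuousMap.coe_smul, fourierCoeff.const_smul, fourierCoeff_mul_fourier, smul_eq_mul, mul_comm]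

theorem sum_norm_sq_toeplitz_le_of_symbol (f : C(UnitAddCircle, ℂ)) {C : ℝ}
    (hf : ∀ y, ‖f y‖ ≤ C) (F G : Finset ℕ) (x : ℕ → ℂ) :
    ∑ i ∈ F, ‖∑ j ∈ G, fourierCoeff f ((i : ℤ) - j) * x j‖ ^ 2 ≤ C ^ 2 * ∑ j ∈ G, ‖x j‖ ^ 2 := by
  set P : C(UnitAddCircle, ℂ) := ∑ j ∈ G, x j • fourier (j : ℤ) with hP
  have hPc : ∀ i : ℤ, fourierCoeff P i = ∑ j ∈ G, if i = j then x j else 0 := fun i => by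
    have := fourierCoeff_sum_mul_fourier 1 G x i
    rw [one_mul, ← hP] at this
    rw [this]
    refine Finset.sum_congr rfl fun j _ => ?_
    have h0 : ((1 : C(UnitAddCircle, ℂ)) : UnitAddCircle → ℂ) = fourier 0 := by
      ext y; simp
    rw [h0, fourierCoeff_fourier]
    simp [Pi.single_apply, sub_eq_zero]
  have hPn : ∫ y, ‖P y‖ ^ 2 ∂haarAddCircle = ∑ j ∈ G, ‖x j‖ ^ 2 := by
    refine (hasSum_sq_norm_fourierCoeff P).unique ?_
    have h1 : HasSum (fun i : ℤ => ‖fourierCoeff P i‖ ^ 2)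
        (∑ i ∈ G.map Nat.castEmbedding, ‖fourierCoeff P i‖ ^ 2) := by
      refine hasSum_sum_of_ne_finset_zero fun i hi => ?_
      rw [hPc, Finset.sum_eq_zero]
      · simp
      · intro j hj
        rw [if_neg]
        rintro rfl
        exact hi (Finset.mem_map_of_mem Nat.castEmbedding hj)
    convert h1 using 1
    rw [Finset.sum_map]
    refine Finset.sum_congr rfl fun j hj => ?_
    simp [hPc, hj]
  have hint : ∀ g : C(UnitAddCircle, ℂ), Integrable (fun y => ‖g y‖ ^ 2) haarAddCircle := fun g =>
    (g.continuous.norm.pow 2).integrable_of_hasCompactSupport (HasCompactSupport.of_compactSpace _)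
  calc ∑ i ∈ F, ‖∑ j ∈ G, fourierCoeff f ((i : ℤ) - j) * x j‖ ^ 2
      = ∑ i ∈ F.map Nat.castEmbedding, ‖fourierCoeff (f * P : C(UnitAddCircle, ℂ)) i‖ ^ 2 := by
        rw [Finset.sum_map]
        simp only [Nat.castEmbedding_apply, hP, fourierCoeff_sum_mul_fourier]
    _ ≤ ∫ y, ‖(f * P) y‖ ^ 2 ∂haarAddCircle :=
        sum_le_hasSum _ (fun _ _ => by positivity) (hasSum_sq_norm_fourierCoeff (f * P))
    _ ≤ ∫ y, C ^ 2 * ‖P y‖ ^ 2 ∂haarAddCircle := by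
        refine integral_mono (hint _) ((hint P).const_mul _) fun y => ?_
        simp only [ContinuousMap.mul_apply, norm_mul, mul_pow]
        gcongr
        exact hf y
    _ = C ^ 2 * ∑ j ∈ G, ‖x j‖ ^ 2 := by rw [integral_const_mul, hPn]

/-- A Toeplitz matrix with absolutely summable diagonals is bounded, on finite sections, by the
supremum of its symbol on the unit circle. -/
theorem sum_norm_sq_toeplitz_le {t : ℤ → ℂ} (ht : Summable fun n => ‖t n‖) {C : ℝ}
    (hC : ∀ z : ℂ, ‖z‖ = 1 → ‖∑' n : ℤ, t n * z ^ n‖ ≤ C) (F G : Finset ℕ) (x : ℕ → ℂ) :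
    ∑ i ∈ F, ‖∑ j ∈ G, t ((i : ℤ) - j) * x j‖ ^ 2 ≤ C ^ 2 * ∑ j ∈ G, ‖x j‖ ^ 2 := by
  have hs : Summable fun n : ℤ => t n • (fourier n : C(UnitAddCircle, ℂ)) :=
    .of_norm (by simpa [norm_smul, fourier_norm] using ht)
  obtain ⟨f, hf⟩ := hs
  have hcoeff : ∀ i, fourierCoeff f i = t i := fun i => by
    let L : C(UnitAddCircle, ℂ) →L[ℂ] ℂ :=
      (innerSL ℂ (fourierLp (T := 1) 2 i)).comp (ContinuousMap.toLp (E := ℂ) 2 haarAddCircle ℂ)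
    have hL : ∀ g : C(UnitAddCircle, ℂ), L g = fourierCoeff g i := fun g => by
      rw [← fourierCoeff_toLp, ← fourierBasis_repr, HilbertBasis.repr_apply_apply,
        coe_fourierBasis]
      rfl
    have h := L.hasSum hf
    simp only [hL, ContinuousMap.coe_smul, fourierCoeff.const_smul, fourierCoeff_fourier] at h
    refine h.unique ?_
    convert hasSum_ite_eq i (t i) using 2 with n
    by_cases hn : n = i
    · simp [hn]
    · simp [hn, Ne.symm hn]
  have hval : ∀ y, ‖f y‖ ≤ C := fun y => by
    have h := (ContinuousMap.evalCLM ℂ y).hasSum hf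
    rw [← show _ = f y from h.tsum_eq]
    convert hC (toCircle y) (Circle.norm_coe _) using 4 with n
    simp [fourier_apply, toCircle_zsmul]
  simpa only [hcoeff] using sum_norm_sq_toeplitz_le_of_symbol f hval F G x

end Fourier

section Shift

variable {S B A : H →L[ℂ] H}

theorem shift_basisVec (hS0 : ∀ a : H, (S a : ℕ → ℂ) 0 = 0)
    (hS1 : ∀ (a : H) (n : ℕ), (S a : ℕ → ℂ) (n + 1) = (a : ℕ → ℂ) n) (n : ℕ) :
    S (basisVec n) = basisVec (n + 1) := by
  ext m
  cases m with
  | zero => simp [hS0]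
  | succ m => simp [hS1, Pi.single_apply]

theorem inner_shift (hS0 : ∀ a : H, (S a : ℕ → ℂ) 0 = 0)
    (hS1 : ∀ (a : H) (n : ℕ), (S a : ℕ → ℂ) (n + 1) = (a : ℕ → ℂ) n)
    (hB : ∀ (a : H) (n : ℕ), (B a : ℕ → ℂ) n = (a : ℕ → ℂ) (n + 1)) (x y : H) :
    inner ℂ (S x) y = inner ℂ x (B y) := by
  have h1 := lp.hasSum_inner (𝕜 := ℂ) (S x) y
  rw [← hasSum_nat_add_iff' 1] at h1
  simp only [hS1, Finset.sum_range_one, hS0, inner_zero_left, sub_zero] at h1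
  refine h1.unique ?_
  simpa only [hB] using lp.hasSum_inner (𝕜 := ℂ) x (B y)

theorem geomVec_sub_smul_shift (hS0 : ∀ a : H, (S a : ℕ → ℂ) 0 = 0)
    (hS1 : ∀ (a : H) (n : ℕ), (S a : ℕ → ℂ) (n + 1) = (a : ℕ → ℂ) n) (w : ℂ) (hw : ‖w‖ < 1) :
    geomVec w hw - w • S (geomVec w hw) = basisVec 0 := by
  ext m
  cases m with
  | zero =>
    rw [lp.coeFn_sub, Pi.sub_apply, lp.coeFn_smul, Pi.smul_apply, hS0]
    simp [geomVec_apply]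
  | succ m =>
    rw [lp.coeFn_sub, Pi.sub_apply, lp.coeFn_smul, Pi.smul_apply, hS1]
    simp [geomVec_apply, pow_succ']

theorem hankel_basisVec_apply (hS0 : ∀ a : H, (S a : ℕ → ℂ) 0 = 0)
    (hS1 : ∀ (a : H) (n : ℕ), (S a : ℕ → ℂ) (n + 1) = (a : ℕ → ℂ) n)
    (hB : ∀ (a : H) (n : ℕ), (B a : ℕ → ℂ) n = (a : ℕ → ℂ) (n + 1))
    (hHankel : B * A = A * S) (n m : ℕ) :
    A (basisVec n) m = A (basisVec 0) (n + m) := by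
  induction n generalizing m with
  | zero => simp
  | succ n ih =>
    have h := DFunLike.congr_fun hHankel (basisVec n)
    simp only [ContinuousLinearMap.mul_def, ContinuousLinearMap.comp_apply] at h
    rw [← shift_basisVec hS0 hS1, ← h, hB, ih, Nat.add_right_comm, Nat.add_assoc]

theorem hankel_form_shift (hS0 : ∀ a : H, (S a : ℕ → ℂ) 0 = 0)
    (hS1 : ∀ (a : H) (n : ℕ), (S a : ℕ → ℂ) (n + 1) = (a : ℕ → ℂ) n)
    (hB : ∀ (a : H) (n : ℕ), (B a : ℕ → ℂ) n = (a : ℕ → ℂ) (n + 1))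
    (hHankel : B * A = A * S) (x y : H) :
    inner ℂ (S x) (A y) = inner ℂ x (A (S y)) := by
  rw [inner_shift hS0 hS1 hB]
  exact congrArg _ (DFunLike.congr_fun hHankel y)

/-- The form of a Hankel operator at a geometric vector, in terms of its matrix entries. -/
theorem hankel_geomVec_identity (hS0 : ∀ a : H, (S a : ℕ → ℂ) 0 = 0)
    (hS1 : ∀ (a : H) (n : ℕ), (S a : ℕ → ℂ) (n + 1) = (a : ℕ → ℂ) n)
    (hB : ∀ (a : H) (n : ℕ), (B a : ℕ → ℂ) n = (a : ℕ → ℂ) (n + 1))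
    (hHankel : B * A = A * S) (w : ℂ) (hw : ‖w‖ < 1) :
    w * inner ℂ (basisVec 0) (A (geomVec w hw)) - star w * inner ℂ (geomVec w hw) (A (basisVec 0)) =
      (w - star w) * inner ℂ (geomVec w hw) (A (geomVec w hw)) := by
  rw [← geomVec_sub_smul_shift hS0 hS1 w hw]
  simp only [map_sub, map_smul, inner_sub_left, inner_sub_right, inner_smul_left,
    inner_smul_right, hankel_form_shift hS0 hS1 hB hHankel, starRingEnd_apply]
  ring

theorem hasSum_hankel_geomVec (hS0 : ∀ a : H, (S a : ℕ → ℂ) 0 = 0)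
    (hS1 : ∀ (a : H) (n : ℕ), (S a : ℕ → ℂ) (n + 1) = (a : ℕ → ℂ) n)
    (hB : ∀ (a : H) (n : ℕ), (B a : ℕ → ℂ) n = (a : ℕ → ℂ) (n + 1))
    (hHankel : B * A = A * S) (w : ℂ) (hw : ‖w‖ < 1) :
    HasSum (fun n => A (basisVec 0) n * w ^ n) (inner ℂ (basisVec 0) (A (geomVec w hw))) := by
  have h := ((innerSL ℂ (basisVec 0)).comp A).hasSum (hasSum_smul_basisVec (geomVec w hw))
  simpa [lp.inner_single_left, hankel_basisVec_apply hS0 hS1 hB hHankel _ 0, geomVec_apply,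
    mul_comm] using h

theorem hasSum_geomVec_hankel (w : ℂ) (hw : ‖w‖ < 1) :
    HasSum (fun n => A (basisVec 0) n * star w ^ n)
      (inner ℂ (geomVec w hw) (A (basisVec 0))) := by
  simpa [geomVec_apply] using lp.hasSum_inner (𝕜 := ℂ) (geomVec w hw) (A (basisVec 0))

/-- The form of a positive Hankel operator at the geometric vector with parameter `ρ * z`, where
`‖z‖ = 1` and `0 < ρ < 1`, is at most `4 * ‖A‖ / |z.im|`. -/
theorem abs_im_mul_hankel_form_le (hS0 : ∀ a : H, (S a : ℕ → ℂ) 0 = 0)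
    (hS1 : ∀ (a : H) (n : ℕ), (S a : ℕ → ℂ) (n + 1) = (a : ℕ → ℂ) n)
    (hB : ∀ (a : H) (n : ℕ), (B a : ℕ → ℂ) n = (a : ℕ → ℂ) (n + 1))
    (hpos : A.IsPositive) (hHankel : B * A = A * S) {z : ℂ} (hz : ‖z‖ = 1) {ρ : ℝ} (hρ0 : 0 < ρ)
    (hρ1 : ρ < 1) (hw : ‖ρ * z‖ < 1) :
    |z.im| * ‖inner ℂ (geomVec (ρ * z) hw) (A (geomVec (ρ * z) hw))‖ ≤ 4 * ‖A‖ := by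
  obtain ⟨X, hX⟩ := exists_sqrt_of_isPositive hpos
  set s : ℝ := |z.im| with hs
  have hs1 : s ≤ 1 := hz ▸ Complex.abs_im_le_norm z
  rcases (abs_nonneg z.im).eq_or_lt with h0 | h0
  · rw [hs, ← h0, zero_mul]; positivity
  rw [← hs] at h0
  have hwn : ‖(((1 - s : ℝ) : ℂ) * (ρ * z))‖ = (1 - s) * ρ := by
    rw [norm_mul, norm_mul, hz, Complex.norm_of_nonneg (by linarith), Complex.norm_of_nonneg hρ0.le,
      mul_one]
  have hw' : ‖(((1 - s : ℝ) : ℂ) * (ρ * z))‖ < 1 := by rw [hwn]; nlinarith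
  set w : ℂ := ρ * z with hwdef
  set K := geomVec w hw
  set K' := geomVec (((1 - s : ℝ) : ℂ) * w) hw'
  obtain ⟨k, hk⟩ : ∃ k : H, k = (s : ℂ)⁻¹ • (K - ((1 - s : ℝ) : ℂ) • K') := ⟨_, rfl⟩
  have hsC : (s : ℂ) ≠ 0 := by exact_mod_cast h0.ne'
  have hKk : K = (s : ℂ) • k + ((1 - s : ℝ) : ℂ) • K' := by
    rw [hk, smul_inv_smul₀ hsC]; abel
  have hkK' : k - w • S k = K' := by
    have h1 : K - w • S K = basisVec 0 := geomVec_sub_smul_shift hS0 hS1 w hw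
    have h2 : K' - (((1 - s : ℝ) : ℂ) * w) • S K' = basisVec 0 :=
      geomVec_sub_smul_shift hS0 hS1 _ hw'
    rw [← sub_eq_zero]
    have h3 : (s : ℂ) • (k - w • S k - K') = 0 := by
      have h4 : (s : ℂ) • k = K - ((1 - s : ℝ) : ℂ) • K' := by rw [hKk]; abel
      have h5 : (s : ℂ) • S k = S K - ((1 - s : ℝ) : ℂ) • S K' := by
        rw [← map_smul, h4, map_sub, map_smul]
      calc (s : ℂ) • (k - w • S k - K')
          = (s : ℂ) • k - w • ((s : ℂ) • S k) - (s : ℂ) • K' := by module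
        _ = (K - w • S K) - (K' - (((1 - s : ℝ) : ℂ) * w) • S K') := by
          rw [h4, h5]; push_cast; module
        _ = 0 := by rw [h1, h2, sub_self]
    exact (smul_eq_zero.1 h3).resolve_left hsC
  have hq : (inner ℂ k (A (S k))).im = 0 := by
    rw [← Complex.conj_eq_iff_im, inner_conj_symm, ← hankel_form_shift hS0 hS1 hB hHankel]
    exact hpos.isSymmetric (S k) k
  have hinner : inner ℂ (X k) (X K') = (‖X k‖ : ℂ) ^ 2 - w * inner ℂ k (A (S k)) := by
    rw [← hX, ← hkK', map_sub, map_smul, inner_sub_right, inner_smul_right, hX k k,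
      inner_self_eq_norm_sq_to_K]
    rfl
  have hlow : s * ‖X k‖ ^ 2 ≤ ‖inner ℂ (X k) (X K')‖ := by
    have h1 : ‖inner ℂ (X k) (X K')‖ = ‖star z * inner ℂ (X k) (X K')‖ := by
      rw [norm_mul, norm_star, hz, one_mul]
    have h2 : star z * z = 1 := by
      rw [Complex.star_def, Complex.conj_mul', hz]; simp
    have h3 : (star z * inner ℂ (X k) (X K')).im = -z.im * ‖X k‖ ^ 2 := by
      have h4 : star z * inner ℂ (X k) (X K') =
          star z * ((‖X k‖ ^ 2 : ℝ) : ℂ) - ρ * inner ℂ k (A (S k)) := by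
        rw [hinner, hwdef]; push_cast; linear_combination (-ρ * inner ℂ k (A (S k))) * h2
      rw [h4]
      simp only [Complex.sub_im, Complex.mul_im, Complex.ofReal_im, Complex.ofReal_re, hq,
        Complex.star_def, Complex.conj_im]
      ring
    rw [h1]
    refine le_trans (le_of_eq ?_) (Complex.abs_im_le_norm _)
    rw [h3, abs_mul, abs_neg, ← hs, abs_of_nonneg (sq_nonneg ‖X k‖)]
  have hsk : s * ‖X k‖ ≤ ‖X K'‖ := by
    have h1 := hlow.trans (norm_inner_le_norm (𝕜 := ℂ) (X k) (X K'))
    rcases (norm_nonneg (X k)).eq_or_lt with h2 | h2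
    · rw [← h2, mul_zero]; positivity
    · refine le_of_mul_le_mul_left ?_ h2
      linarith
  have hXK : ‖X K‖ ≤ 2 * ‖X K'‖ := by
    rw [hKk, map_add, map_smul, map_smul]
    refine (norm_add_le _ _).trans ?_
    rw [norm_smul, norm_smul, Complex.norm_of_nonneg h0.le,
      Complex.norm_of_nonneg (sub_nonneg.2 hs1)]
    nlinarith [norm_nonneg (X K')]
  have hXK' : s * ‖X K'‖ ^ 2 ≤ ‖A‖ := by
    have h1 : ‖X K'‖ ^ 2 ≤ ‖A‖ * ‖K'‖ ^ 2 := by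
      have h2 : ‖X K'‖ ^ 2 = ‖inner ℂ K' (A K')‖ := by
        rw [hX, inner_self_eq_norm_sq_to_K]; simp
      rw [h2]
      calc ‖inner ℂ K' (A K')‖ ≤ ‖K'‖ * ‖A K'‖ := norm_inner_le_norm _ _
        _ ≤ ‖K'‖ * (‖A‖ * ‖K'‖) := by gcongr; exact A.le_opNorm _
        _ = ‖A‖ * ‖K'‖ ^ 2 := by ring
    have h3 : s ≤ 1 - ((1 - s) * ρ) ^ 2 := by
      have : (1 - s) * ρ ≤ 1 - s := by nlinarith
      have : 0 ≤ (1 - s) * ρ := mul_nonneg (by linarith) hρ0.le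
      nlinarith
    rw [norm_geomVec_sq, hwn] at h1
    calc s * ‖X K'‖ ^ 2 ≤ s * (‖A‖ * (1 - ((1 - s) * ρ) ^ 2)⁻¹) := by gcongr
      _ = ‖A‖ * (s / (1 - ((1 - s) * ρ) ^ 2)) := by ring
      _ ≤ ‖A‖ * 1 := by gcongr; exact (div_le_one (h0.trans_le h3)).2 h3
      _ = ‖A‖ := mul_one _
  have hfin : ‖inner ℂ K (A K)‖ = ‖X K‖ ^ 2 := by
    rw [hX, inner_self_eq_norm_sq_to_K]; simp
  rw [hfin]
  have : ‖X K‖ ^ 2 ≤ (2 * ‖X K'‖) ^ 2 := by gcongr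
  nlinarith

/-- The diagonals of the skew Toeplitz matrix whose subdiagonal part is given by `a`. -/
def skewDiagonal (a : ℕ → ℂ) : ℤ → ℂ
  | .ofNat 0 => 0
  | .ofNat (n + 1) => a n
  | .negSucc n => -a n

theorem skewDiagonal_zero (a : ℕ → ℂ) : skewDiagonal a 0 = 0 := rfl

theorem skewDiagonal_succ (a : ℕ → ℂ) (n : ℕ) : skewDiagonal a (n + 1) = a n := rfl

theorem skewDiagonal_neg_succ (a : ℕ → ℂ) (n : ℕ) : skewDiagonal a (-(n + 1)) = -a n := by
  rw [← Int.negSucc_eq]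
  rfl

theorem hasSum_int_of_pos_of_neg {f : ℤ → ℂ} {p q : ℂ} (h0 : f 0 = 0)
    (hp : HasSum (fun n : ℕ => f (n + 1)) p) (hq : HasSum (fun n : ℕ => f (-(n + 1))) q) :
    HasSum f (p + q) := by
  refine HasSum.of_nat_of_neg_add_one ?_ hq
  rw [← hasSum_nat_add_iff' 1]
  simpa [h0] using hp

/-- The symbol of the damped skew Toeplitz matrix attached to a Hankel operator. -/
theorem hasSum_damped_skewDiagonal (hS0 : ∀ a : H, (S a : ℕ → ℂ) 0 = 0)
    (hS1 : ∀ (a : H) (n : ℕ), (S a : ℕ → ℂ) (n + 1) = (a : ℕ → ℂ) n)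
    (hB : ∀ (a : H) (n : ℕ), (B a : ℕ → ℂ) n = (a : ℕ → ℂ) (n + 1))
    (hHankel : B * A = A * S) (ρ : ℝ) {z : ℂ} (hz : ‖z‖ = 1) (hw : ‖ρ * z‖ < 1) :
    HasSum (fun n : ℤ => ((ρ : ℂ) ^ n.natAbs * skewDiagonal (A (basisVec 0)) n) * z ^ n)
      ((ρ * z - star (ρ * z)) *
        inner ℂ (geomVec (ρ * z) hw) (A (geomVec (ρ * z) hw))) := by
  have hz' : z⁻¹ = star z := by
    rw [Complex.inv_def, Complex.normSq_eq_norm_sq, hz]; simp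
  rw [← hankel_geomVec_identity hS0 hS1 hB hHankel, sub_eq_add_neg]
  refine hasSum_int_of_pos_of_neg (by simp [skewDiagonal_zero])
    (((hasSum_hankel_geomVec hS0 hS1 hB hHankel (ρ * z) hw).mul_left (ρ * z)).congr_fun
      fun n => ?_)
    (((hasSum_geomVec_hankel (A := A) (ρ * z) hw).mul_left (star (ρ * z))).neg.congr_fun
      fun n => ?_)
  · rw [show ((n : ℤ) + 1).natAbs = n + 1 by lia, skewDiagonal_succ, ← Nat.cast_succ, zpow_natCast,
      Nat.succ_eq_add_one]
    ring
  · rw [show (-((n : ℤ) + 1)).natAbs = n + 1 by lia, skewDiagonal_neg_succ, zpow_neg,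
      ← Nat.cast_succ, zpow_natCast, ← inv_pow, hz', Nat.succ_eq_add_one, star_mul',
      show star (ρ : ℂ) = ρ from Complex.conj_ofReal ρ]
    ring

theorem norm_hankel_symbol_le (hS0 : ∀ a : H, (S a : ℕ → ℂ) 0 = 0)
    (hS1 : ∀ (a : H) (n : ℕ), (S a : ℕ → ℂ) (n + 1) = (a : ℕ → ℂ) n)
    (hB : ∀ (a : H) (n : ℕ), (B a : ℕ → ℂ) n = (a : ℕ → ℂ) (n + 1))
    (hpos : A.IsPositive) (hHankel : B * A = A * S) {z : ℂ} (hz : ‖z‖ = 1) {ρ : ℝ} (hρ0 : 0 < ρ)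
    (hρ1 : ρ < 1) (hw : ‖ρ * z‖ < 1) :
    ‖(ρ * z - star (ρ * z)) * inner ℂ (geomVec (ρ * z) hw) (A (geomVec (ρ * z) hw))‖ ≤
      8 * ‖A‖ := by
  have h1 : ‖ρ * z - star (ρ * z)‖ ≤ 2 * |z.im| := by
    rw [Complex.star_def, Complex.sub_conj, norm_mul, Complex.norm_I, mul_one, Complex.norm_real,
      Real.norm_eq_abs, Complex.im_ofReal_mul, abs_mul, abs_two, abs_mul, abs_of_pos hρ0]
    nlinarith [abs_nonneg z.im]
  rw [norm_mul]
  refine (mul_le_mul_of_nonneg_right h1 (norm_nonneg _)).trans ?_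
  linarith [abs_im_mul_hankel_form_le hS0 hS1 hB hpos hHankel hz hρ0 hρ1 hw]

theorem sum_norm_sq_damped_skew_toeplitz_le (hS0 : ∀ a : H, (S a : ℕ → ℂ) 0 = 0)
    (hS1 : ∀ (a : H) (n : ℕ), (S a : ℕ → ℂ) (n + 1) = (a : ℕ → ℂ) n)
    (hB : ∀ (a : H) (n : ℕ), (B a : ℕ → ℂ) n = (a : ℕ → ℂ) (n + 1))
    (hpos : A.IsPositive) (hHankel : B * A = A * S) {ρ : ℝ} (hρ0 : 0 < ρ) (hρ1 : ρ < 1)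
    (F G : Finset ℕ) (x : ℕ → ℂ) :
    ∑ i ∈ F, ‖∑ j ∈ G, ((ρ : ℂ) ^ ((i : ℤ) - j).natAbs *
      skewDiagonal (A (basisVec 0)) ((i : ℤ) - j)) * x j‖ ^ 2 ≤
      (8 * ‖A‖) ^ 2 * ∑ j ∈ G, ‖x j‖ ^ 2 := by
  have hlt : ∀ z : ℂ, ‖z‖ = 1 → ‖ρ * z‖ < 1 := fun z hz => by
    rwa [norm_mul, hz, mul_one, Complex.norm_of_nonneg hρ0.le]
  have hsum := fun (z : ℂ) (hz : ‖z‖ = 1) =>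
    hasSum_damped_skewDiagonal hS0 hS1 hB hHankel ρ hz (hlt z hz)
  refine sum_norm_sq_toeplitz_le
    (t := fun n => (ρ : ℂ) ^ n.natAbs * skewDiagonal (A (basisVec 0)) n) ?_ (fun z hz => ?_) F G x
  · simpa only [one_zpow, mul_one] using (hsum 1 norm_one).summable.norm
  · rw [(hsum z hz).tsum_eq]
    exact norm_hankel_symbol_le hS0 hS1 hB hpos hHankel hz hρ0 hρ1 (hlt z hz)

theorem sum_norm_sq_skew_toeplitz_le (hS0 : ∀ a : H, (S a : ℕ → ℂ) 0 = 0)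
    (hS1 : ∀ (a : H) (n : ℕ), (S a : ℕ → ℂ) (n + 1) = (a : ℕ → ℂ) n)
    (hB : ∀ (a : H) (n : ℕ), (B a : ℕ → ℂ) n = (a : ℕ → ℂ) (n + 1))
    (hpos : A.IsPositive) (hHankel : B * A = A * S) (F G : Finset ℕ) (x : ℕ → ℂ) :
    ∑ i ∈ F, ‖∑ j ∈ G, skewDiagonal (A (basisVec 0)) ((i : ℤ) - j) * x j‖ ^ 2 ≤
      (8 * ‖A‖) ^ 2 * ∑ j ∈ G, ‖x j‖ ^ 2 := by
  have hcont : Continuous fun ρ : ℝ => ∑ i ∈ F, ‖∑ j ∈ G, ((ρ : ℂ) ^ ((i : ℤ) - j).natAbs *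
      skewDiagonal (A (basisVec 0)) ((i : ℤ) - j)) * x j‖ ^ 2 := by
    fun_prop
  have hlim := (hcont.tendsto 1).mono_left (nhdsWithin_le_nhds (s := Set.Iio 1))
  simp only [Complex.ofReal_one, one_pow, one_mul] at hlim
  refine le_of_tendsto hlim ?_
  filter_upwards [Ioo_mem_nhdsLT (zero_lt_one' ℝ)] with ρ hρ
  exact sum_norm_sq_damped_skew_toeplitz_le hS0 hS1 hB hpos hHankel hρ.1 hρ.2 F G x

theorem shift_leftInverse (hS1 : ∀ (a : H) (n : ℕ), (S a : ℕ → ℂ) (n + 1) = (a : ℕ → ℂ) n)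
    (hB : ∀ (a : H) (n : ℕ), (B a : ℕ → ℂ) n = (a : ℕ → ℂ) (n + 1)) (x : H) :
    B (S x) = x := by
  ext n
  rw [hB, hS1]

theorem shift_backwardShift (hS0 : ∀ a : H, (S a : ℕ → ℂ) 0 = 0)
    (hS1 : ∀ (a : H) (n : ℕ), (S a : ℕ → ℂ) (n + 1) = (a : ℕ → ℂ) n)
    (hB : ∀ (a : H) (n : ℕ), (B a : ℕ → ℂ) n = (a : ℕ → ℂ) (n + 1)) (x : H) :
    S (B x) = x - x 0 • basisVec 0 := by
  ext n
  rw [lp.coeFn_sub, Pi.sub_apply, lp.coeFn_smul, Pi.smul_apply]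
  cases n with
  | zero => simp [hS0]
  | succ n => simp [hS1, hB]

/-- If a Toeplitz operator `T` has the same first column as the Hankel operator `A`, up to the
shift, and the opposite first row, then `A ^ 2 - T ^ 2` is a Toeplitz operator. -/
theorem isToeplitz_sq_sub_sq {T : H →L[ℂ] H} (hS0 : ∀ a : H, (S a : ℕ → ℂ) 0 = 0)
    (hS1 : ∀ (a : H) (n : ℕ), (S a : ℕ → ℂ) (n + 1) = (a : ℕ → ℂ) n)
    (hB : ∀ (a : H) (n : ℕ), (B a : ℕ → ℂ) n = (a : ℕ → ℂ) (n + 1))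
    (hHankel : ∀ x, B (A x) = A (S x)) (hT : ∀ x, B (T (S x)) = T x)
    (hcol : B (T (basisVec 0)) = A (basisVec 0)) (hrow : ∀ x, T (S x) 0 = -A x 0) (x : H) :
    B ((A * A - T * T) (S x)) = (A * A - T * T) x := by
  have h1 : ∀ y : H, B (T y) = T (B y) + y 0 • A (basisVec 0) := fun y => by
    have hy : y = S (B y) + y 0 • basisVec 0 := by
      rw [shift_backwardShift hS0 hS1 hB, sub_add_cancel]
    conv_lhs => rw [hy]
    rw [map_add, map_add, hT, map_smul, map_smul, hcol]
  simp only [sub_apply, ContinuousLinearMap.mul_def,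
    ContinuousLinearMap.comp_apply, map_sub]
  rw [h1, hT, hrow, hHankel, ← hHankel x, shift_backwardShift hS0 hS1 hB, map_sub, map_smul,
    neg_smul]
  abel

theorem exists_isToeplitz_of_hankel (hS0 : ∀ a : H, (S a : ℕ → ℂ) 0 = 0)
    (hS1 : ∀ (a : H) (n : ℕ), (S a : ℕ → ℂ) (n + 1) = (a : ℕ → ℂ) n)
    (hB : ∀ (a : H) (n : ℕ), (B a : ℕ → ℂ) n = (a : ℕ → ℂ) (n + 1))
    (hpos : A.IsPositive) (hHankel : B * A = A * S) :
    ∃ T : H →L[ℂ] H, B * T * S = T ∧ B (T (basisVec 0)) = A (basisVec 0) ∧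
      ∀ x, T (S x) 0 = -A x 0 := by
  obtain ⟨T, hT⟩ := exists_clm_of_finite_sections
    (fun i j => skewDiagonal (A (basisVec 0)) ((i : ℤ) - j)) (8 * ‖A‖)
    (sum_norm_sq_skew_toeplitz_le hS0 hS1 hB hpos hHankel)
  refine ⟨T, clm_ext_basisVec fun j => ?_, ?_, fun x => ?_⟩
  · ext i
    change B (T (S (basisVec j))) i = T (basisVec j) i
    rw [hB, shift_basisVec hS0 hS1, hT, hT]
    congr 1
    push_cast
    ring
  · ext i
    rw [hB, hT, Nat.cast_zero, sub_zero, Nat.cast_succ, skewDiagonal_succ]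
  · have h : ((innerSL ℂ (basisVec 0)).comp T).comp S = -(innerSL ℂ (basisVec 0)).comp A := by
      refine clm_ext_basisVec fun j => ?_
      simp only [ContinuousLinearMap.comp_apply, neg_apply, innerSL_apply_apply,
        lp.inner_single_left, shift_basisVec hS0 hS1, hT,
        hankel_basisVec_apply hS0 hS1 hB hHankel j 0]
      rw [Nat.cast_zero, zero_sub, Nat.cast_succ, skewDiagonal_neg_succ]
      simp
    simpa [lp.inner_single_left] using DFunLike.congr_fun h x

end Shift

/-- Every positive bounded Hankel operator belongs to the Toeplitz algebra, i.e. to the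
operator-norm closure of the subalgebra generated by the Toeplitz operators. -/
theorem positive_Hankel_mem_ToeplitzAlgebra (S B A : H →L[ℂ] H)
    (hS0 : ∀ a : H, (S a : ℕ → ℂ) 0 = 0)
    (hS1 : ∀ (a : H) (n : ℕ), (S a : ℕ → ℂ) (n + 1) = (a : ℕ → ℂ) n)
    (hB : ∀ (a : H) (n : ℕ), (B a : ℕ → ℂ) n = (a : ℕ → ℂ) (n + 1))
    (hpos : A.IsPositive)
    (hHankel : B * A = A * S) :
    A ∈ (Algebra.adjoin ℂ
        ({T : H →L[ℂ] H | B * T * S = T} : Set (H →L[ℂ] H))).topologicalClosure := by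
  obtain ⟨T, hT, hcol, hrow⟩ := exists_isToeplitz_of_hankel hS0 hS1 hB hpos hHankel
  refine mem_topologicalClosure_of_mul_self_mem _
    ((ContinuousLinearMap.nonneg_iff_isPositive A).2 hpos) ?_
  rw [← sub_add_cancel (A * A) (T * T)]
  have hTmem : T ∈ Algebra.adjoin ℂ ({T : H →L[ℂ] H | B * T * S = T} : Set (H →L[ℂ] H)) :=
    Algebra.subset_adjoin hT
  refine add_mem (Algebra.subset_adjoin ?_) (mul_mem hTmem hTmem)
  ext1 x
  exact isToeplitz_sq_sub_sq hS0 hS1 hB (DFunLike.congr_fun hHankel) (DFunLike.congr_fun hT)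
    hcol hrow x
end

section
/- Let A be a bounded operator on ℓ² satisfying the Toeplitz condition S* A S = A. If ‖A e_n‖ → 0 as n → ∞, where (e_n) is the standard orthonormal basis of ℓ², then A = 0. (Consequently, if a Toeplitz operator differs from an operator annihilating the basis asymptotically by a compact operator, the Toeplitz operator is zero.) -/
open Filter Finset

local notation "H" => lp (fun _ : ℕ => ℂ) 2

/-- A forward shift maps each standard basis vector to the next one. -/
theorem shift_single (S : H →L[ℂ] H)
    (hS0 : ∀ a : H, (S a : ℕ → ℂ) 0 = 0)
    (hS1 : ∀ (a : H) (n : ℕ), (S a : ℕ → ℂ) (n + 1) = (a : ℕ → ℂ) n) (n : ℕ) :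
    S (lp.single 2 n (1 : ℂ)) = lp.single 2 (n + 1) (1 : ℂ) := by
  refine lp.ext (funext fun m => ?_)
  cases m with
  | zero => rw [hS0]; simp
  | succ m => rw [hS1]; simp [Pi.single_apply]

/-- The matrix entries of a Toeplitz operator are constant along diagonals. -/
theorem toeplitz_entry_add (S B A : H →L[ℂ] H)
    (hS0 : ∀ a : H, (S a : ℕ → ℂ) 0 = 0)
    (hS1 : ∀ (a : H) (n : ℕ), (S a : ℕ → ℂ) (n + 1) = (a : ℕ → ℂ) n)
    (hB : ∀ (a : H) (n : ℕ), (B a : ℕ → ℂ) n = (a : ℕ → ℂ) (n + 1))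
    (hToep : B * A * S = A) (n m k : ℕ) :
    (A (lp.single 2 (n + k) (1 : ℂ)) : ℕ → ℂ) (m + k) = (A (lp.single 2 n (1 : ℂ)) : ℕ → ℂ) m := by
  induction k with
  | zero => rfl
  | succ k ih =>
    rw [← ih, ← add_assoc, ← add_assoc, ← shift_single S hS0 hS1, ← hB]
    exact congrArg (fun T : H →L[ℂ] H => (T (lp.single 2 (n + k) (1 : ℂ)) : ℕ → ℂ) (m + k)) hToep

/-- A Toeplitz operator whose values on the standard basis tend to zero in norm is zero. -/
theorem Toeplitz_basis_tendsto_zero (S B A : H →L[ℂ] H)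
    (hS0 : ∀ a : H, (S a : ℕ → ℂ) 0 = 0)
    (hS1 : ∀ (a : H) (n : ℕ), (S a : ℕ → ℂ) (n + 1) = (a : ℕ → ℂ) n)
    (hB : ∀ (a : H) (n : ℕ), (B a : ℕ → ℂ) n = (a : ℕ → ℂ) (n + 1))
    (hToep : B * A * S = A)
    (hlim : Tendsto (fun n : ℕ => ‖A (lp.single 2 n (1 : ℂ))‖) atTop (nhds 0)) :
    A = 0 := by
  have hbasis (n : ℕ) : A (lp.single 2 n (1 : ℂ)) = 0 := by
    refine lp.ext (funext fun m => ?_)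
    have hle : ‖(A (lp.single 2 n (1 : ℂ)) : ℕ → ℂ) m‖ ≤ 0 := by
      refine ge_of_tendsto' (hlim.comp (tendsto_add_atTop_nat n)) fun k => ?_
      rw [← toeplitz_entry_add S B A hS0 hS1 hB hToep n m k, add_comm n k]
      exact lp.norm_apply_le_norm two_ne_zero _ _
    exact norm_le_zero_iff.mp hle
  refine ContinuousLinearMap.ext fun a => ?_
  have hsum := A.hasSum (lp.hasSum_single (p := 2) (by norm_num) a)
  refine hsum.unique ?_
  have hzero (n : ℕ) : A (lp.single 2 n ((a : ℕ → ℂ) n)) = 0 := by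
    have hsmul : lp.single (E := fun _ : ℕ => ℂ) 2 n ((a : ℕ → ℂ) n)
        = (a : ℕ → ℂ) n • lp.single (E := fun _ : ℕ => ℂ) 2 n (1 : ℂ) := by
      rw [← lp.single_smul, smul_eq_mul, mul_one]
    rw [hsmul, map_smul, hbasis, smul_zero]
  simpa only [hzero, zero_apply] using
    (hasSum_zero : HasSum (fun _ : ℕ => (0 : H)) 0)
end
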